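/- arXiv:1811.00175 — 5 statements merged into one kernel-verified Lean document; each statement's English description precedes it below -/
import Mathlib

section
/- Program-counter containment during attestation: suppose an MCU trace satisfies LTL Specification (2), i.e., at every time, ¬reset ∧ (PC ∈ CR) ∧ ¬(X(PC) ∈ CR) → PC = CR_max ∨ X(reset). Let t be a time with PC(t) = CR_min and suppose (¬reset U PC = CR_max) holds at t; let t* be the least time ≥ t with PC(t*) = CR_max. Then PC(u) ∈ CR for every u with t ≤ u ≤ t*. Moreover, if the trace additionally satisfies LTL Specification (4) (at every time, irq ∧ (PC ∈ CR) → reset), then irq(u) is false for every u with t ≤ u < t*. -/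
/-- program-counter containment during attestation. If a trace satisfies
LTL Specification (2), t is a time with PC(t) = CR_min at which (¬reset U PC = CR_max)
holds, and t* is the least time ≥ t with PC(t*) = CR_max, then PC(u) ∈ CR for all
t ≤ u ≤ t*; moreover, if the trace additionally satisfies LTL Specification (4),
then irq(u) is false for all t ≤ u < t*. -/
theorem pc_containment_during_attestation
    (CRmin CRmax : ℕ)
    (hCR : 0 < CRmin ∧ CRmin < CRmax)
    (PC : ℕ → ℕ)
    (irq reset : ℕ → Prop)
    (hspec2 : ∀ u : ℕ,
      (¬reset u ∧ (CRmin ≤ PC u ∧ PC u ≤ CRmax) ∧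
        ¬(CRmin ≤ PC (u + 1) ∧ PC (u + 1) ≤ CRmax)) →
      (PC u = CRmax ∨ reset (u + 1)))
    (t tstar : ℕ)
    (ht : PC t = CRmin)
    (huntil : ∃ t', t ≤ t' ∧ PC t' = CRmax ∧ ∀ u, t ≤ u → u < t' → ¬reset u)
    (htstar : t ≤ tstar ∧ PC tstar = CRmax ∧ ∀ u, t ≤ u → u < tstar → PC u ≠ CRmax) :
    (∀ u, t ≤ u → u ≤ tstar → (CRmin ≤ PC u ∧ PC u ≤ CRmax)) ∧
    ((∀ u : ℕ, (irq u ∧ (CRmin ≤ PC u ∧ PC u ≤ CRmax)) → reset u) →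
      ∀ u, t ≤ u → u < tstar → ¬irq u) := by
  obtain ⟨t', htt', hPCt', hnr⟩ := huntil
  obtain ⟨hts, hPCs, hmin⟩ := htstar
  have hle : tstar ≤ t' := by
    by_contra! h
    exact hmin t' htt' h hPCt'
  have hnr' : ∀ u, t ≤ u → u < tstar → ¬reset u := fun u h₁ h₂ => hnr u h₁ (by omega)
  have hin : ∀ u, t ≤ u → u ≤ tstar → (CRmin ≤ PC u ∧ PC u ≤ CRmax) := by
    intro u hu
    induction u, hu using Nat.le_induction with
    | base => intro _; omega
    | succ u hu ih =>
      intro hus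
      rcases Nat.eq_or_lt_of_le hus with heq | hlt
      · rw [heq, hPCs]
        omega
      · by_contra hout
        rcases hspec2 u ⟨hnr' u hu hus, ih (by omega), hout⟩ with hmax | hreset
        · exact hmin u hu hus hmax
        · exact hnr' (u + 1) (by omega) hlt hreset
  exact ⟨hin, fun hspec4 u hu hus hirq =>
    hnr' u hu hus (hspec4 u ⟨hirq, hin u hu hus.le⟩)⟩
end

section
/- Controlled invocation (property P7): suppose an MCU trace satisfies LTL Specifications (2) and (3), i.e., at every time, ¬reset ∧ (PC ∈ CR) ∧ ¬(X(PC) ∈ CR) → PC = CR_max ∨ X(reset), and ¬reset ∧ ¬(PC ∈ CR) ∧ (X(PC) ∈ CR) → X(PC) = CR_min ∨ X(reset). If additionally reset(t) is false for all t and PC(0) ∉ CR, then for every time t with PC(t) ∈ CR there exists a time a ≤ t such that PC(a) = CR_min and PC(u) ∈ CR for every u with a ≤ u ≤ t. In other words, it is impossible to execute inside SW-Att without having entered it through its first instruction. -/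
/-- controlled invocation (property P7). If a trace satisfies LTL
Specifications (2) and (3), reset is everywhere false, and PC(0) ∉ CR, then whenever
PC(t) ∈ CR there is a time a ≤ t with PC(a) = CR_min and PC(u) ∈ CR for all
a ≤ u ≤ t: SW-Att can only be executed by entering through its first instruction. -/
theorem controlled_invocation
    (CRmin CRmax : ℕ)
    (hCR : 0 < CRmin ∧ CRmin < CRmax)
    (PC : ℕ → ℕ)
    (reset : ℕ → Prop)
    (hspec2 : ∀ u : ℕ,
      (¬reset u ∧ (CRmin ≤ PC u ∧ PC u ≤ CRmax) ∧
        ¬(CRmin ≤ PC (u + 1) ∧ PC (u + 1) ≤ CRmax)) →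
      (PC u = CRmax ∨ reset (u + 1)))
    (hspec3 : ∀ u : ℕ,
      (¬reset u ∧ ¬(CRmin ≤ PC u ∧ PC u ≤ CRmax) ∧
        (CRmin ≤ PC (u + 1) ∧ PC (u + 1) ≤ CRmax)) →
      (PC (u + 1) = CRmin ∨ reset (u + 1)))
    (hnoreset : ∀ u : ℕ, ¬reset u)
    (h0 : ¬(CRmin ≤ PC 0 ∧ PC 0 ≤ CRmax)) :
    ∀ t : ℕ, (CRmin ≤ PC t ∧ PC t ≤ CRmax) →
      ∃ a, a ≤ t ∧ PC a = CRmin ∧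
        ∀ u, a ≤ u → u ≤ t → (CRmin ≤ PC u ∧ PC u ≤ CRmax) := by
  intro t
  induction t with
  | zero => exact fun ht => absurd ht h0
  | succ n ih =>
    intro ht
    by_cases hn : CRmin ≤ PC n ∧ PC n ≤ CRmax
    · obtain ⟨a, han, ha, hin⟩ := ih hn
      refine ⟨a, han.trans n.le_succ, ha, fun u hau hu => ?_⟩
      rcases Nat.le_succ_iff.mp hu with hu | rfl
      · exact hin u hau hu
      · exact ht
    · have hentry := (hspec3 n ⟨hnoreset n, hn, ht⟩).resolve_right (hnoreset (n + 1))
      refine ⟨n + 1, le_rfl, hentry, fun u hau hu => ?_⟩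
      rwa [le_antisymm hu hau]
end

section
/- Lemma 1 (Temporal consistency): attested memory does not change during SW-Att computation. Suppose an MCU trace together with a content trace AR_content : ℕ → V (the contents of the attested region AR, valued in an arbitrary type V) satisfies: (i) the execution model for memory modification — for every t, if AR_content(t+1) ≠ AR_content(t) then there exists an address i ∈ AR with (W_en(t) ∧ D_addr(t) = i) ∨ (DMA_en(t) ∧ DMA_addr(t) = i); (ii) LTL Specification (2): at every time, ¬reset ∧ (PC ∈ CR) ∧ ¬(X(PC) ∈ CR) → PC = CR_max ∨ X(reset); (iii) LTL Specification (6): at every time, (PC ∈ CR) ∧ W_en ∧ ¬(D_addr ∈ XS) ∧ ¬(D_addr ∈ MR) → reset; (iv) LTL Specification (9): at every time, (PC ∈ CR) ∧ DMA_en → reset; and (v) AR is disjoint from XS and from MR. Then at every time the following holds: { PC = CR_min ∧ AR_content = M ∧ (¬reset U PC = CR_max) → (AR_content = M U PC = CR_max) }, for every value M. -/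
/-- Lemma 1, temporal consistency: attested memory does not change
during SW-Att computation. Under the execution model for memory modification,
LTL Specifications (2), (6), (9), and disjointness of AR from XS and MR, at every
time t and for every value M:
PC = CR_min ∧ AR_content = M ∧ (¬reset U PC = CR_max) →
(AR_content = M U PC = CR_max). -/
theorem temporal_consistency
    {V : Type*}
    (CRmin CRmax XSmin XSmax MRmin MRmax ARmin ARmax : ℕ)
    (hCR : 0 < CRmin ∧ CRmin < CRmax)
    (PC Daddr DMAaddr : ℕ → ℕ)
    (irq Ren Wen DMAen reset : ℕ → Prop)
    (ARcontent : ℕ → V)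
    -- (i) execution model: AR contents only change via a CPU write or DMA access
    -- to an address in AR
    (hexec : ∀ t : ℕ, ARcontent (t + 1) ≠ ARcontent t →
      ∃ i, (ARmin ≤ i ∧ i ≤ ARmax) ∧
        ((Wen t ∧ Daddr t = i) ∨ (DMAen t ∧ DMAaddr t = i)))
    -- (ii) LTL Specification (2)
    (hspec2 : ∀ t : ℕ,
      (¬reset t ∧ (CRmin ≤ PC t ∧ PC t ≤ CRmax) ∧
        ¬(CRmin ≤ PC (t + 1) ∧ PC (t + 1) ≤ CRmax)) →
      (PC t = CRmax ∨ reset (t + 1)))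
    -- (iii) LTL Specification (6)
    (hspec6 : ∀ t : ℕ,
      ((CRmin ≤ PC t ∧ PC t ≤ CRmax) ∧ Wen t ∧
        ¬(XSmin ≤ Daddr t ∧ Daddr t ≤ XSmax) ∧
        ¬(MRmin ≤ Daddr t ∧ Daddr t ≤ MRmax)) → reset t)
    -- (iv) LTL Specification (9)
    (hspec9 : ∀ t : ℕ, ((CRmin ≤ PC t ∧ PC t ≤ CRmax) ∧ DMAen t) → reset t)
    -- (v) AR is disjoint from XS and from MR
    (hdisjXS : ∀ i : ℕ, (ARmin ≤ i ∧ i ≤ ARmax) → ¬(XSmin ≤ i ∧ i ≤ XSmax))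
    (hdisjMR : ∀ i : ℕ, (ARmin ≤ i ∧ i ≤ ARmax) → ¬(MRmin ≤ i ∧ i ≤ MRmax)) :
    ∀ (t : ℕ) (M : V),
      PC t = CRmin → ARcontent t = M →
      (∃ t', t ≤ t' ∧ PC t' = CRmax ∧ ∀ u, t ≤ u → u < t' → ¬reset u) →
      (∃ t', t ≤ t' ∧ PC t' = CRmax ∧ ∀ u, t ≤ u → u < t' → ARcontent u = M) := by
  classical
  intro t M hPC hM hex
  obtain ⟨hle, hmax, hres⟩ := Nat.find_spec hex
  have hmin := fun m => Nat.find_min (m := m) hex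
  generalize Nat.find hex = t' at hle hmax hres hmin
  refine ⟨t', hle, hmax, ?_⟩
  suffices h : ∀ u, t ≤ u → u < t' → (CRmin ≤ PC u ∧ PC u ≤ CRmax) ∧ ARcontent u = M from
    fun u h₁ h₂ => (h u h₁ h₂).2
  intro u hu
  induction u, hu using Nat.le_induction with
  | base => exact fun _ => ⟨by omega, hM⟩
  | succ u hu ih =>
    intro hlt
    obtain ⟨hin, hcontent⟩ := ih (by omega)
    have hnr : ¬reset u := hres u hu (by omega)
    have hne : PC u ≠ CRmax := fun h =>
      hmin u (by omega) ⟨hu, h, fun v h₁ h₂ => hres v h₁ (by omega)⟩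
    constructor
    · by_contra hout
      exact (hspec2 u ⟨hnr, hin, hout⟩).elim hne (hres (u + 1) (by omega) hlt)
    · by_contra hchange
      obtain ⟨i, hi, ⟨hw, rfl⟩ | ⟨hd, -⟩⟩ := hexec u (fun h => hchange (h.trans hcontent))
      · exact hnr (hspec6 u ⟨hin, hw, hdisjXS _ hi, hdisjMR _ hi⟩)
      · exact hnr (hspec9 u ⟨hin, hd⟩)
end

section
/- Theorem 1 (RA soundness of VRASED): functional correctness of SW-Att together with LTL Specifications (2), (4), (6), (9) implies the end-to-end soundness property of Definition 1. Precisely: let H : C × V → W be a fixed function (representing (Chal, M) ↦ HMAC(KDF(K, Chal), M) for the ROM-resident key K). Suppose an MCU trace, together with content traces AR_content : ℕ → V (attested region contents) and MR_content : ℕ → (C ⊕ W) (MAC/challenge region contents), satisfies: (i) the execution model — if AR_content(t+1) ≠ AR_content(t) then there exists i ∈ AR with (W_en(t) ∧ D_addr(t) = i) ∨ (DMA_en(t) ∧ DMA_addr(t) = i); (ii) LTL Specifications (2), (4), (6), (9); (iii) AR is disjoint from XS and from MR; and (iv) SW-Att functional correctness (Definition 3): for all values M and Chal, at every time, { PC =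 CR_min ∧ MR_content = Chal ∧ [(¬reset ∧ ¬irq ∧ AR_content = M) U PC = CR_max] → F [ PC = CR_max ∧ MR_content = H(Chal, M) ] }. Then the soundness property of Definition 1 holds: for all values M and Chal, at every time, { PC = CR_min ∧ AR_content = M ∧ MR_content = Chal ∧ [(¬reset) U PC = CR_max] → F [ PC = CR_max ∧ MR_content = H(Chal, M) ] }. -/
/-- Theorem 1, RA soundness of VRASED: functional correctness of
SW-Att (Definition 3) together with LTL Specifications (2), (4), (6), (9), the
execution model for the attested region, and disjointness of AR from XS and MR,
implies the end-to-end soundness property of Definition 1: for all M, Chal and at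
every time,
PC = CR_min ∧ AR_content = M ∧ MR_content = Chal ∧ [(¬reset) U PC = CR_max] →
F [ PC = CR_max ∧ MR_content = H(Chal, M) ].
Here `H : C × V → W` is the fixed function (Chal, M) ↦ HMAC(KDF(K, Chal), M) for the
ROM-resident key, and MR contents are valued in `C ⊕ W` (a challenge or a MAC). -/
theorem ra_soundness
    {C V W : Type*}
    (H : C × V → W)
    (CRmin CRmax XSmin XSmax MRmin MRmax ARmin ARmax : ℕ)
    (hCR : 0 < CRmin ∧ CRmin < CRmax)
    (PC Daddr DMAaddr : ℕ → ℕ)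
    (irq Ren Wen DMAen reset : ℕ → Prop)
    (ARcontent : ℕ → V)
    (MRcontent : ℕ → C ⊕ W)
    -- (i) execution model: AR contents only change via a CPU write or DMA access
    -- to an address in AR
    (hexec : ∀ t : ℕ, ARcontent (t + 1) ≠ ARcontent t →
      ∃ i, (ARmin ≤ i ∧ i ≤ ARmax) ∧
        ((Wen t ∧ Daddr t = i) ∨ (DMAen t ∧ DMAaddr t = i)))
    -- (ii) LTL Specifications (2), (4), (6), (9)
    (hspec2 : ∀ t : ℕ,
      (¬reset t ∧ (CRmin ≤ PC t ∧ PC t ≤ CRmax) ∧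
        ¬(CRmin ≤ PC (t + 1) ∧ PC (t + 1) ≤ CRmax)) →
      (PC t = CRmax ∨ reset (t + 1)))
    (hspec4 : ∀ t : ℕ, (irq t ∧ (CRmin ≤ PC t ∧ PC t ≤ CRmax)) → reset t)
    (hspec6 : ∀ t : ℕ,
      ((CRmin ≤ PC t ∧ PC t ≤ CRmax) ∧ Wen t ∧
        ¬(XSmin ≤ Daddr t ∧ Daddr t ≤ XSmax) ∧
        ¬(MRmin ≤ Daddr t ∧ Daddr t ≤ MRmax)) → reset t)
    (hspec9 : ∀ t : ℕ, ((CRmin ≤ PC t ∧ PC t ≤ CRmax) ∧ DMAen t) → reset t)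
    -- (iii) AR is disjoint from XS and from MR
    (hdisjXS : ∀ i : ℕ, (ARmin ≤ i ∧ i ≤ ARmax) → ¬(XSmin ≤ i ∧ i ≤ XSmax))
    (hdisjMR : ∀ i : ℕ, (ARmin ≤ i ∧ i ≤ ARmax) → ¬(MRmin ≤ i ∧ i ≤ MRmax))
    -- (iv) SW-Att functional correctness (Definition 3)
    (hfc : ∀ (M : V) (Chal : C) (t : ℕ),
      PC t = CRmin → MRcontent t = Sum.inl Chal →
      (∃ t', t ≤ t' ∧ PC t' = CRmax ∧
        ∀ u, t ≤ u → u < t' → (¬reset u ∧ ¬irq u ∧ ARcontent u = M)) →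
      (∃ t'', t ≤ t'' ∧ PC t'' = CRmax ∧ MRcontent t'' = Sum.inr (H (Chal, M)))) :
    -- Definition 1 (RA soundness)
    ∀ (M : V) (Chal : C) (t : ℕ),
      PC t = CRmin → ARcontent t = M → MRcontent t = Sum.inl Chal →
      (∃ t', t ≤ t' ∧ PC t' = CRmax ∧ ∀ u, t ≤ u → u < t' → ¬reset u) →
      (∃ t'', t ≤ t'' ∧ PC t'' = CRmax ∧ MRcontent t'' = Sum.inr (H (Chal, M))) := by
  classical
  intro M Chal t hPC hAR hMR ⟨s, hts, hPCs, hreset⟩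
  -- the first time at which `PC = CRmax`
  have hex : ∃ n, t ≤ n ∧ PC n = CRmax := ⟨s, hts, hPCs⟩
  obtain ⟨n, ⟨htn, hPCn⟩, hmin⟩ : ∃ n, (t ≤ n ∧ PC n = CRmax) ∧
      ∀ m < n, ¬(t ≤ m ∧ PC m = CRmax) :=
    ⟨Nat.find hex, Nat.find_spec hex, fun m hm => Nat.find_min hex hm⟩
  have hns : n ≤ s := not_lt.mp fun h => hmin s h ⟨hts, hPCs⟩
  have hinv : ∀ u, t ≤ u → u < n → (CRmin ≤ PC u ∧ PC u ≤ CRmax) ∧ ARcontent u = M := by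
    intro u htu
    induction u, htu using Nat.le_induction with
    | base => exact fun _ => ⟨by omega, hAR⟩
    | succ u htu ih =>
      intro hu
      obtain ⟨hCRu, hARu⟩ := ih (by omega)
      have hru : ¬reset u := hreset u htu (by omega)
      constructor
      · by_contra hout
        rcases hspec2 u ⟨hru, hCRu, hout⟩ with h | h
        · exact hmin u (by omega) ⟨htu, h⟩
        · exact hreset (u + 1) (by omega) (by omega) h
      · by_contra hne
        obtain ⟨i, hi, ⟨hw, rfl⟩ | ⟨hd, -⟩⟩ := hexec u fun h => hne (h.trans hARu)
        · exact hru (hspec6 u ⟨hCRu, hw, hdisjXS _ hi, hdisjMR _ hi⟩)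
        · exact hru (hspec9 u ⟨hCRu, hd⟩)
  refine hfc M Chal t hPC hMR ⟨n, htn, hPCn, fun u htu hun => ?_⟩
  obtain ⟨hCRu, hARu⟩ := hinv u htu hun
  have hru : ¬reset u := hreset u htu (by omega)
  exact ⟨hru, fun hirq => hru (hspec4 u ⟨hirq, hCRu⟩), hARu⟩
end

section
/- Lemma 2 (Key confidentiality): LTL Specifications (1), (5), (6), (7), (8), (9) imply that the key region cannot be accessed by untrusted software and that any memory written by SW-Att outside MR can never be read by untrusted software. Precisely: define Read_Mem(i)(t) := (R_en(t) ∧ D_addr(t) = i) ∨ (DMA_en(t) ∧ DMA_addr(t) = i) and Modify_Mem(i)(t) := (W_en(t) ∧ D_addr(t) = i) ∨ (DMA_en(t) ∧ DMA_addr(t) = i). Suppose an MCU trace satisfies, at every time: (1) ¬(PC ∈ CR) ∧ R_en ∧ (D_addr ∈ KR) → reset; (5) ¬(PC ∈ CR) ∧ (R_en ∨ W_en) ∧ (D_addr ∈ XS) → reset; (6) (PC ∈ CR) ∧ W_en ∧ ¬(D_addr ∈ XS) ∧ ¬(D_addr ∈ MR) → reset; (7) DMA_en ∧ (DMA_addr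 ∈ KR) → reset; (8) DMA_en ∧ (DMA_addr ∈ XS) → reset; and (9) (PC ∈ CR) ∧ DMA_en → reset. Then for every address i, at every time the following all hold: (a) ¬(PC ∈ CR) ∧ Read_Mem(i) ∧ i ∈ KR → reset; (b) DMA_en ∧ DMA_addr = i ∧ i ∈ KR → reset; and (c) ¬reset ∧ (PC ∈ CR) ∧ Modify_Mem(i) ∧ ¬(i ∈ MR) → G { ((¬(PC ∈ CR) ∧ Read_Mem(i)) ∨ (DMA_en ∧ DMA_addr = i)) → reset }. -/
/-- Lemma 2, key confidentiality: LTL Specifications (1), (5), (6),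
(7), (8), (9) imply that the key region cannot be accessed by untrusted software and
that any memory written by SW-Att outside MR can never be read by untrusted software.
Here Read_Mem(i)(t) := (R_en(t) ∧ D_addr(t) = i) ∨ (DMA_en(t) ∧ DMA_addr(t) = i) and
Modify_Mem(i)(t) := (W_en(t) ∧ D_addr(t) = i) ∨ (DMA_en(t) ∧ DMA_addr(t) = i). -/
theorem key_confidentiality
    (CRmin CRmax Kmin Kmax XSmin XSmax MRmin MRmax : ℕ)
    (hCR : 0 < CRmin ∧ CRmin < CRmax)
    (PC Daddr DMAaddr : ℕ → ℕ)
    (irq Ren Wen DMAen reset : ℕ → Prop)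
    -- LTL Specification (1)
    (hspec1 : ∀ t : ℕ,
      (¬(CRmin ≤ PC t ∧ PC t ≤ CRmax) ∧ Ren t ∧ (Kmin ≤ Daddr t ∧ Daddr t ≤ Kmax)) →
      reset t)
    -- LTL Specification (5)
    (hspec5 : ∀ t : ℕ,
      (¬(CRmin ≤ PC t ∧ PC t ≤ CRmax) ∧ (Ren t ∨ Wen t) ∧
        (XSmin ≤ Daddr t ∧ Daddr t ≤ XSmax)) → reset t)
    -- LTL Specification (6)
    (hspec6 : ∀ t : ℕ,
      ((CRmin ≤ PC t ∧ PC t ≤ CRmax) ∧ Wen t ∧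
        ¬(XSmin ≤ Daddr t ∧ Daddr t ≤ XSmax) ∧
        ¬(MRmin ≤ Daddr t ∧ Daddr t ≤ MRmax)) → reset t)
    -- LTL Specification (7)
    (hspec7 : ∀ t : ℕ, (DMAen t ∧ (Kmin ≤ DMAaddr t ∧ DMAaddr t ≤ Kmax)) → reset t)
    -- LTL Specification (8)
    (hspec8 : ∀ t : ℕ, (DMAen t ∧ (XSmin ≤ DMAaddr t ∧ DMAaddr t ≤ XSmax)) → reset t)
    -- LTL Specification (9)
    (hspec9 : ∀ t : ℕ, ((CRmin ≤ PC t ∧ PC t ≤ CRmax) ∧ DMAen t) → reset t) :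
    ∀ (i : ℕ) (t : ℕ),
      -- (a)
      ((¬(CRmin ≤ PC t ∧ PC t ≤ CRmax) ∧
          ((Ren t ∧ Daddr t = i) ∨ (DMAen t ∧ DMAaddr t = i)) ∧
          (Kmin ≤ i ∧ i ≤ Kmax)) → reset t) ∧
      -- (b)
      ((DMAen t ∧ DMAaddr t = i ∧ (Kmin ≤ i ∧ i ≤ Kmax)) → reset t) ∧
      -- (c)
      ((¬reset t ∧ (CRmin ≤ PC t ∧ PC t ≤ CRmax) ∧
          ((Wen t ∧ Daddr t = i) ∨ (DMAen t ∧ DMAaddr t = i)) ∧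
          ¬(MRmin ≤ i ∧ i ≤ MRmax)) →
        ∀ u, t ≤ u →
          ((¬(CRmin ≤ PC u ∧ PC u ≤ CRmax) ∧
              ((Ren u ∧ Daddr u = i) ∨ (DMAen u ∧ DMAaddr u = i))) ∨
            (DMAen u ∧ DMAaddr u = i)) →
          reset u) := by
  intro i t
  refine ⟨?_, ?_, ?_⟩
  · rintro ⟨hPC, ⟨hR, rfl⟩ | ⟨hD, rfl⟩, hK⟩
    · exact hspec1 t ⟨hPC, hR, hK⟩
    · exact hspec7 t ⟨hD, hK⟩
  · rintro ⟨hD, rfl, hK⟩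
    exact hspec7 t ⟨hD, hK⟩
  · rintro ⟨hreset, hPC, hmod, hMR⟩ u -
    have hXS : XSmin ≤ i ∧ i ≤ XSmax := by
      rcases hmod with ⟨hW, rfl⟩ | ⟨hD, -⟩
      · by_contra hXS
        exact hreset (hspec6 t ⟨hPC, hW, hXS, hMR⟩)
      · exact absurd (hspec9 t ⟨hPC, hD⟩) hreset
    rintro (⟨hPCu, ⟨hR, hi⟩ | ⟨hD, hi⟩⟩ | ⟨hD, hi⟩)
    · exact hspec5 u ⟨hPCu, Or.inl hR, hi ▸ hXS⟩
    · exact hspec8 u ⟨hD, hi ▸ hXS⟩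
    · exact hspec8 u ⟨hD, hi ▸ hXS⟩
end
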